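/- For every positive integer n, the reconstruction number of 𝔽₂^n is exactly ⌊n + 1 − log₂(n + 1 − log₂ n)⌋. That is, writing r = ⌊n + 1 − log₂(n + 1 − log₂ n)⌋: any two subsets of 𝔽₂^n that are r-indistinguishable are translates of one another, and there exist two subsets of 𝔽₂^n that are (r−1)-indistinguishable but are not translates of one another. -/

import Mathlib

open Finset

/-- The `k`-deck of a multiset `φ : G → ℕ`. -/
def deck {G : Type*} [Fintype G] [AddCommGroup G] (k : ℕ) (φ : G → ℕ) :
    (Fin k → G) → ℕ :=
  fun s => ∑ g : G, ∏ i, φ (g + s i)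

/-- `φ` and `ψ` are `k`-indistinguishable if their `i`-decks agree for all `i ≤ k`. -/
def Indist {G : Type*} [Fintype G] [AddCommGroup G] (k : ℕ) (φ ψ : G → ℕ) : Prop :=
  ∀ i, i ≤ k → deck i φ = deck i ψ

/-- The indicator function of a finite subset. -/
def indic {G : Type*} [DecidableEq G] (A : Finset G) : G → ℕ :=
  fun x => if x ∈ A then 1 else 0

theorem pow_bounds_of_floor {n r : ℕ} (hn : 0 < n)
    (hr : (r : ℤ) = ⌊(n : ℝ) + 1 - Real.logb 2 ((n : ℝ) + 1 - Real.logb 2 n)⌋) :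
    r ≤ n ∧ r ≤ 2 ^ (n + 1 - r) ∧ 2 ^ (n - r) < r + 1 := by
  have hlog : Real.logb 2 n < n := by
    rw [Real.logb_lt_iff_lt_rpow (by norm_num) (by exact_mod_cast hn), Real.rpow_natCast]
    exact_mod_cast Nat.lt_two_pow_self
  set X : ℝ := (n : ℝ) + 1 - Real.logb 2 n with hX
  have hX1 : 1 < X := by linarith
  obtain ⟨h1, h2⟩ := Int.floor_eq_iff.1 hr.symm
  push_cast at h1 h2
  have hXlog : 0 < Real.logb 2 X := Real.logb_pos (by norm_num) hX1
  have hrn : r ≤ n := by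
    have : (r : ℝ) < n + 1 := by linarith
    exact Nat.lt_succ_iff.1 (by exact_mod_cast this)
  obtain ⟨d, rfl⟩ := Nat.exists_eq_add_of_le hrn
  have e1 : r + d + 1 - r = d + 1 := by omega
  have e2 : r + d - r = d := by omega
  rw [e1, e2]
  push_cast at h1 h2 hX
  have k1 : X ≤ 2 ^ (d + 1) := by
    have : Real.logb 2 X ≤ ((d + 1 : ℕ) : ℝ) := by push_cast; linarith
    rwa [Real.logb_le_iff_le_rpow (by norm_num) (by linarith), Real.rpow_natCast] at this
  have k2 : 2 ^ d < X := by
    have : ((d : ℕ) : ℝ) < Real.logb 2 X := by linarith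
    rwa [Real.lt_logb_iff_rpow_lt (by norm_num) (by linarith), Real.rpow_natCast] at this
  have hpos : (0 : ℝ) < r + d := by exact_mod_cast hn
  refine ⟨hrn, ?_, ?_⟩
  · by_contra! hlt
    obtain ⟨t, ht⟩ := Nat.exists_eq_add_of_lt hlt
    have h3 : (((t + d + 1 + 1 : ℕ)) : ℝ) ≤ Real.logb 2 ((r : ℝ) + d) := by
      have : (r : ℝ) = 2 ^ (d + 1) + t + 1 := by exact_mod_cast ht
      push_cast
      linarith
    rw [Real.le_logb_iff_rpow_le (by norm_num) hpos, Real.rpow_natCast] at h3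
    have h4 : 2 ^ (t + d + 1 + 1) ≤ r + d := by exact_mod_cast h3
    have h5 : 2 ^ (d + 1) ≤ 2 ^ (t + d + 1) := Nat.pow_le_pow_right (by norm_num) (by omega)
    have h6 : t + d + 1 < 2 ^ (t + d + 1) := Nat.lt_two_pow_self
    rw [pow_succ] at h4
    omega
  · by_contra! hle
    have h3 : Real.logb 2 ((r : ℝ) + d) < (d : ℕ) := by
      have : (r : ℝ) + 1 ≤ 2 ^ d := by exact_mod_cast hle
      linarith
    rw [Real.logb_lt_iff_lt_rpow (by norm_num) hpos, Real.rpow_natCast] at h3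
    have h4 : r + d < 2 ^ d := by exact_mod_cast h3
    have h5 : Real.logb 2 ((r : ℝ) + d) < 0 := by
      have : (r : ℝ) + d + 1 ≤ 2 ^ d := by exact_mod_cast h4
      linarith
    have h6 : 0 ≤ Real.logb 2 ((r : ℝ) + d) :=
      Real.logb_nonneg (by norm_num) (by exact_mod_cast hn)
    linarith

theorem ZMod.add_self_two (a : ZMod 2) : a + a = 0 := CharTwo.add_self_eq_zero a

theorem ZMod.eq_of_eq_zero_iff {a b : ZMod 2} (h : a = 0 ↔ b = 0) : a = b := by
  revert a b; decide

/-- The `m + 1` functionals on `𝔽₂^m` given by the coordinates and their sum: they add up to zero,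
and any `m` of them are linearly independent. -/
def circuitForm {m : ℕ} (x : Fin m → ZMod 2) : Fin (m + 1) → ZMod 2 :=
  Fin.snoc x (∑ i, x i)

theorem circuitForm_add {m : ℕ} (x y : Fin m → ZMod 2) :
    circuitForm (x + y) = circuitForm x + circuitForm y := by
  ext q
  refine Fin.lastCases ?_ (fun q => ?_) q <;> simp [circuitForm, sum_add_distrib]

theorem circuitForm_zero {m : ℕ} : circuitForm (0 : Fin m → ZMod 2) = 0 := by
  ext q
  refine Fin.lastCases ?_ (fun q => ?_) q <;> simp [circuitForm]

theorem sum_circuitForm {m : ℕ} (x : Fin m → ZMod 2) : ∑ q, circuitForm x q = 0 := by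
  simp [Fin.sum_univ_castSucc, circuitForm, ZMod.add_self_two]

theorem exists_circuitForm_eq_single {m : ℕ} (j : Fin (m + 1)) :
    ∃ x : Fin m → ZMod 2, ∀ q ≠ j,
      circuitForm x q = (Pi.single (Fin.last m) 1 : Fin (m + 1) → ZMod 2) q := by
  induction j using Fin.lastCases with
  | last => exact ⟨0, fun q hq => by simp [circuitForm_zero, hq]⟩
  | cast j =>
    refine ⟨Pi.single j 1, fun q => ?_⟩
    refine Fin.lastCases (fun _ => ?_) (fun q hq => ?_) q
    · simp [circuitForm]
    · have hqj : q ≠ j := fun h => hq (by rw [h])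
      simp [circuitForm, hqj, (Fin.castSucc_lt_last q).ne]

/-- The union, over the cosets of an `m`-dimensional subspace labelled by `lab`, of the affine
hyperplanes on which the functional named by the label equals `c`. -/
def circuitSet {m d : ℕ} (lab : (Fin d → ZMod 2) → Fin (m + 1)) (c : Fin (m + 1) → ZMod 2) :
    Finset (Fin (m + d) → ZMod 2) :=
  {v | circuitForm (fun i => v (Fin.castAdd d i)) (lab fun i => v (Fin.natAdd m i)) =
    c (lab fun i => v (Fin.natAdd m i))}

theorem mem_circuitSet {m d : ℕ} {lab : (Fin d → ZMod 2) → Fin (m + 1)}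
    {c : Fin (m + 1) → ZMod 2} {v : Fin (m + d) → ZMod 2} {x : Fin m → ZMod 2}
    {y : Fin d → ZMod 2} (hx : (fun i => v (Fin.castAdd d i)) = x)
    (hy : (fun i => v (Fin.natAdd m i)) = y) :
    v ∈ circuitSet lab c ↔ circuitForm x (lab y) = c (lab y) := by
  simp [circuitSet, hx, hy]

theorem indist_circuitSet {m d : ℕ} (lab : (Fin d → ZMod 2) → Fin (m + 1)) :
    Indist m (indic (circuitSet lab 0)) (indic (circuitSet lab (Pi.single (Fin.last m) 1))) := by
  intro k hk
  ext s
  have hmiss : ∀ y : Fin d → ZMod 2, ∃ x : Fin m → ZMod 2, ∀ p : Fin k,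
      circuitForm x (lab (y + fun i => s p (Fin.natAdd m i))) =
        (Pi.single (Fin.last m) 1 : Fin (m + 1) → ZMod 2)
          (lab (y + fun i => s p (Fin.natAdd m i))) := by
    intro y
    obtain ⟨j, hj⟩ : ∃ j : Fin (m + 1), ∀ p : Fin k, lab (y + fun i => s p (Fin.natAdd m i)) ≠ j := by
      by_contra! h
      have := Fintype.card_le_of_surjective _ h
      simp at this
      omega
    obtain ⟨x, hx⟩ := exists_circuitForm_eq_single j
    exact ⟨x, fun p => hx _ (hj p)⟩
  choose x hx using hmiss
  let τ : (Fin (m + d) → ZMod 2) → Fin (m + d) → ZMod 2 := fun v =>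
    v + Fin.append (x fun i => v (Fin.natAdd m i)) 0
  have hτ : Function.Involutive τ := by
    intro v
    have h : (fun i => τ v (Fin.natAdd m i)) = fun i => v (Fin.natAdd m i) := by
      ext i; simp [τ]
    change τ v + Fin.append (x fun i => τ v (Fin.natAdd m i)) 0 = v
    rw [h]
    simp only [τ, add_assoc]
    rw [add_eq_left]
    ext i
    exact ZMod.add_self_two _
  refine Fintype.sum_equiv hτ.toPerm _ _ fun v => Finset.prod_congr rfl fun p _ => ?_
  have hy : (fun i => (τ v + s p) (Fin.natAdd m i)) = fun i => (v + s p) (Fin.natAdd m i) := by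
    ext i; simp [τ]
  have hx' : (fun i => (τ v + s p) (Fin.castAdd d i)) =
      (fun i => (v + s p) (Fin.castAdd d i)) + x fun i => v (Fin.natAdd m i) := by
    ext i; simp [τ]; ring
  have := hx (fun i => v (Fin.natAdd m i)) p
  have hmem : v + s p ∈ circuitSet lab 0 ↔
      τ v + s p ∈ circuitSet lab (Pi.single (Fin.last m) 1) := by
    rw [mem_circuitSet rfl rfl, mem_circuitSet hx' hy, circuitForm_add, Pi.add_apply,
      Pi.zero_apply, ← add_eq_right (b := (Pi.single (Fin.last m) 1 : Fin (m + 1) → ZMod 2) _)]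
    exact Eq.congr_left (congrArg _ this.symm)
  exact if_congr hmem rfl rfl

theorem circuitSet_not_translate {m d : ℕ} {lab : (Fin d → ZMod 2) → Fin (m + 1)}
    (hlab : Function.Surjective lab) :
    ¬ ∃ z, circuitSet lab (Pi.single (Fin.last m) 1) =
      (circuitSet lab 0).image (fun x => z + x) := by
  rintro ⟨z, hz⟩
  set c : Fin (m + 1) → ZMod 2 := Pi.single (Fin.last m) 1 with hc
  set zx : Fin m → ZMod 2 := fun i => z (Fin.castAdd d i) with hzx
  set zy : Fin d → ZMod 2 := fun i => z (Fin.natAdd m i) with hzy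
  have hzz : ∀ v, z + (z + v) = v := fun v => by
    ext i; simp [← add_assoc, ZMod.add_self_two]
  have key : ∀ x y, circuitForm x (lab y) + c (lab y) =
      circuitForm x (lab (zy + y)) + circuitForm zx (lab (zy + y)) := by
    intro x y
    have h : Fin.append x y ∈ circuitSet lab c ↔ z + Fin.append x y ∈ circuitSet lab 0 := by
      rw [hz, mem_image]
      exact ⟨fun ⟨w, hw, e⟩ => by rwa [← e, hzz], fun h => ⟨_, h, hzz _⟩⟩
    have e1 : (fun i => (z + Fin.append x y) (Fin.castAdd d i)) = x + zx := by
      ext i; simp [hzx, add_comm]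
    have e2 : (fun i => (z + Fin.append x y) (Fin.natAdd m i)) = zy + y := by
      ext i; simp [hzy]
    rw [mem_circuitSet e1 e2, mem_circuitSet (x := x) (y := y) (by ext; simp) (by ext; simp),
      circuitForm_add] at h
    refine ZMod.eq_of_eq_zero_iff (Iff.trans ?_ h)
    rw [CharTwo.add_eq_zero]
  have hz' : ∀ q, circuitForm zx q = c q := by
    intro q
    obtain ⟨y, rfl⟩ := hlab q
    have h0 := key 0 y
    have h1 := key zx y
    rw [ZMod.add_self_two] at h1
    rwa [CharTwo.add_eq_zero] at h1
  have := sum_circuitForm zx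
  simp [hz', hc] at this

theorem exists_indist_not_translate {m d : ℕ} (h : m + 1 ≤ 2 ^ d) :
    ∃ A B : Finset (Fin (m + d) → ZMod 2), Indist m (indic A) (indic B) ∧
      ¬ ∃ z : Fin (m + d) → ZMod 2, B = A.image (fun x => z + x) := by
  obtain ⟨f⟩ : Nonempty (Fin (m + 1) ↪ (Fin d → ZMod 2)) :=
    Function.Embedding.nonempty_of_card_le (by simpa [ZMod.card] using h)
  exact ⟨_, _, indist_circuitSet _, circuitSet_not_translate (Function.invFun_surjective f.2)⟩

/-- The nontrivial additive character of `𝔽₂`, with values `±1`. -/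
def signChar (a : ZMod 2) : ℤ := if a = 0 then 1 else -1

theorem signChar_zero : signChar 0 = 1 := rfl

theorem signChar_add (a b : ZMod 2) : signChar (a + b) = signChar a * signChar b := by
  revert a b; decide

theorem signChar_mul_self (a : ZMod 2) : signChar a * signChar a = 1 := by
  revert a; decide

theorem signChar_ne_zero (a : ZMod 2) : signChar a ≠ 0 := by
  revert a; decide

theorem signChar_sum {ι : Type*} (s : Finset ι) (f : ι → ZMod 2) :
    signChar (∑ i ∈ s, f i) = ∏ i ∈ s, signChar (f i) := by
  classical
  induction s using Finset.induction_on with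
  | empty => simp [signChar_zero]
  | insert a s ha ih => rw [sum_insert ha, prod_insert ha, signChar_add, ih]

theorem signChar_eq_one_iff {a : ZMod 2} : signChar a = 1 ↔ a = 0 := by
  revert a; decide

section Fourier

variable {n : ℕ}

theorem vec_add_self (x : Fin n → ZMod 2) : x + x = 0 :=
  funext fun i => CharTwo.add_self_eq_zero (x i)

theorem vec_add_eq_zero {x y : Fin n → ZMod 2} : x + y = 0 ↔ x = y := by
  simp only [funext_iff, Pi.add_apply, Pi.zero_apply, CharTwo.add_eq_zero]

theorem sum_signChar_dotProduct (x : Fin n → ZMod 2) :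
    ∑ χ : Fin n → ZMod 2, signChar (χ ⬝ᵥ x) = if x = 0 then 2 ^ n else 0 := by
  split_ifs with h
  · simp [h, signChar_zero, ZMod.card]
  · obtain ⟨i, hi⟩ := Function.ne_iff.1 h
    have hi' : x i = 1 := by
      have : ∀ a : ZMod 2, a ≠ 0 → a = 1 := by decide
      exact this _ hi
    have := Equiv.sum_comp (Equiv.addLeft (Pi.single i 1)) fun χ : Fin n → ZMod 2 =>
      signChar (χ ⬝ᵥ x)
    have h1 : signChar 1 = -1 := rfl
    simp only [Equiv.coe_addLeft, add_dotProduct, single_dotProduct, hi', one_mul, signChar_add, h1,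
      neg_mul, sum_neg_distrib] at this
    linarith

/-- The Fourier transform of the indicator function of `A`. -/
def fourierInd (A : Finset (Fin n → ZMod 2)) (χ : Fin n → ZMod 2) : ℤ :=
  ∑ x ∈ A, signChar (χ ⬝ᵥ x)

theorem fourierInd_zero (A : Finset (Fin n → ZMod 2)) : fourierInd A 0 = #A := by
  simp [fourierInd, signChar_zero]

theorem fourierInd_univ (χ : Fin n → ZMod 2) :
    fourierInd univ χ = if χ = 0 then 2 ^ n else 0 := by
  rw [← sum_signChar_dotProduct]
  simp [fourierInd, dotProduct_comm]

theorem sum_fourierInd_mul_signChar (A : Finset (Fin n → ZMod 2)) (y : Fin n → ZMod 2) :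
    ∑ χ, fourierInd A χ * signChar (χ ⬝ᵥ y) = if y ∈ A then 2 ^ n else 0 := by
  simp only [fourierInd, sum_mul, ← signChar_add, ← dotProduct_add]
  rw [sum_comm]
  simp only [sum_signChar_dotProduct, vec_add_eq_zero]
  simp

theorem fourierInd_injective :
    Function.Injective (fourierInd : Finset (Fin n → ZMod 2) → (Fin n → ZMod 2) → ℤ) := by
  intro A B h
  ext y
  have hA := sum_fourierInd_mul_signChar A y
  rw [h, sum_fourierInd_mul_signChar B y] at hA
  have h2 : (0 : ℤ) ≠ 2 ^ n := by positivity
  by_cases hA' : y ∈ A <;> by_cases hB' : y ∈ B <;> simp_all [h2.symm]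

theorem fourierInd_image_add (A : Finset (Fin n → ZMod 2)) (z χ : Fin n → ZMod 2) :
    fourierInd (A.image fun x => z + x) χ = signChar (χ ⬝ᵥ z) * fourierInd A χ := by
  rw [fourierInd, sum_image fun _ _ _ _ h => add_left_cancel h]
  simp only [dotProduct_add, signChar_add, fourierInd, mul_sum]

theorem sum_indic_add_mul_signChar (A : Finset (Fin n → ZMod 2)) (g χ : Fin n → ZMod 2) :
    ∑ x, (indic A (g + x) : ℤ) * signChar (χ ⬝ᵥ x) = signChar (χ ⬝ᵥ g) * fourierInd A χ := by
  have := Equiv.sum_comp (Equiv.addLeft g) fun x : Fin n → ZMod 2 =>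
    signChar (χ ⬝ᵥ g) * ((indic A x : ℤ) * signChar (χ ⬝ᵥ x))
  simp only [Equiv.coe_addLeft, dotProduct_add, signChar_add] at this
  rw [← mul_sum (f := fun x => (indic A x : ℤ) * signChar (χ ⬝ᵥ x))] at this
  have h2 : fourierInd A χ = ∑ x, (indic A x : ℤ) * signChar (χ ⬝ᵥ x) := by
    simp [indic, fourierInd]
  rw [h2, ← this]
  refine sum_congr rfl fun x _ => ?_
  linear_combination -(indic A (g + x) : ℤ) * signChar (χ ⬝ᵥ x) * signChar_mul_self (χ ⬝ᵥ g)

theorem sum_deck_mul_signChar {k : ℕ} (A : Finset (Fin n → ZMod 2)) {χ : Fin k → Fin n → ZMod 2}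
    (hχ : ∑ i, χ i = 0) :
    ∑ s, (deck k (indic A) s : ℤ) * ∏ i, signChar (χ i ⬝ᵥ s i) =
      2 ^ n * ∏ i, fourierInd A (χ i) := by
  simp only [deck, Nat.cast_sum, Nat.cast_prod, sum_mul, ← prod_mul_distrib]
  rw [sum_comm]
  have : ∀ g : Fin n → ZMod 2, ∑ s : Fin k → Fin n → ZMod 2,
      ∏ i, (indic A (g + s i) : ℤ) * signChar (χ i ⬝ᵥ s i) = ∏ i, fourierInd A (χ i) := by
    intro g
    have h := Finset.prod_univ_sum (fun _ : Fin k => (univ : Finset (Fin n → ZMod 2)))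
      fun i x => (indic A (g + x) : ℤ) * signChar (χ i ⬝ᵥ x)
    rw [Fintype.piFinset_univ] at h
    rw [← h]
    simp only [sum_indic_add_mul_signChar, prod_mul_distrib]
    rw [← signChar_sum, ← sum_dotProduct, hχ, zero_dotProduct, signChar_zero, one_mul]
  simp [this, ZMod.card]

theorem prod_fourierInd_eq {r : ℕ} {A B : Finset (Fin n → ZMod 2)}
    (h : Indist r (indic A) (indic B)) {k : ℕ} (hk : k ≤ r) {χ : Fin k → Fin n → ZMod 2}
    (hχ : ∑ i, χ i = 0) : ∏ i, fourierInd A (χ i) = ∏ i, fourierInd B (χ i) := by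
  have hA := sum_deck_mul_signChar A hχ
  rw [h k hk, sum_deck_mul_signChar B hχ] at hA
  exact (mul_left_cancel₀ (by positivity) hA).symm

theorem prod_finset_fourierInd_eq {r : ℕ} {A B : Finset (Fin n → ZMod 2)}
    (h : Indist r (indic A) (indic B)) {R : Finset (Fin n → ZMod 2)} (hR : #R ≤ r)
    (hsum : ∑ χ ∈ R, χ = 0) : ∏ χ ∈ R, fourierInd A χ = ∏ χ ∈ R, fourierInd B χ := by
  have hχ : ∑ i, (R.equivFin.symm i : Fin n → ZMod 2) = 0 := by
    rw [Equiv.sum_comp R.equivFin.symm fun x : R => (x : Fin n → ZMod 2), sum_coe_sort R fun x => x,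
      hsum]
  have := prod_fourierInd_eq h hR hχ
  rwa [Equiv.prod_comp R.equivFin.symm fun x : R => fourierInd A x,
    Equiv.prod_comp R.equivFin.symm fun x : R => fourierInd B x, prod_coe_sort R (fourierInd A),
    prod_coe_sort R (fourierInd B)] at this

/-- A function on a subset of `𝔽₂^n` that respects all linear relations extends to a linear
functional. -/
theorem exists_dotProduct_eq (S : Set (Fin n → ZMod 2)) (e : (Fin n → ZMod 2) → ZMod 2)
    (h : ∀ R : Finset (Fin n → ZMod 2), ↑R ⊆ S → ∑ χ ∈ R, χ = 0 → ∑ χ ∈ R, e χ = 0) :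
    ∃ z : Fin n → ZMod 2, ∀ χ ∈ S, χ ⬝ᵥ z = e χ := by
  have hone : ∀ a : ZMod 2, a ≠ 0 → a = 1 := by decide
  set v : (Fin n → ZMod 2) → (Fin n → ZMod 2) × ZMod 2 := fun χ => (χ, e χ) with hv
  have hnot : ((0, 1) : (Fin n → ZMod 2) × ZMod 2) ∉ Submodule.span (ZMod 2) (v '' S) := by
    rw [Finsupp.mem_span_image_iff_linearCombination]
    rintro ⟨l, hl, hl'⟩
    have hl1 : ∑ χ ∈ l.support, v χ = (0, 1) := by
      rw [← hl', Finsupp.linearCombination_apply, Finsupp.sum]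
      refine sum_congr rfl fun χ hχ => ?_
      rw [hone _ (Finsupp.mem_support_iff.1 hχ), one_smul]
    have h1 := congrArg Prod.fst hl1
    have h2 := congrArg Prod.snd hl1
    rw [Prod.fst_sum] at h1
    rw [Prod.snd_sum, h l.support ((Finsupp.mem_supported _ _).1 hl) h1] at h2
    exact zero_ne_one h2
  obtain ⟨f, hf, hker⟩ := Submodule.exists_le_ker_of_notMem hnot
  refine ⟨fun i => f (Pi.single i 1, 0), fun χ hχ => ?_⟩
  have h0 : f (χ, e χ) = 0 := hker (Submodule.subset_span ⟨χ, hχ, rfl⟩)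
  have hsplit : (χ, e χ) = (χ, (0 : ZMod 2)) + e χ • ((0, 1) : (Fin n → ZMod 2) × ZMod 2) := by
    simp
  have hχ' : f (χ, 0) = χ ⬝ᵥ fun i => f (Pi.single i 1, 0) := by
    have := LinearMap.pi_apply_eq_sum_univ (f ∘ₗ LinearMap.inl (ZMod 2) (Fin n → ZMod 2) (ZMod 2)) χ
    simp only [LinearMap.comp_apply, LinearMap.inl_apply, smul_eq_mul] at this
    rw [this, dotProduct]
    refine sum_congr rfl fun i _ => ?_
    congr 3
    ext j
    simp [Pi.single_apply, eq_comm]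
  rw [hsplit, map_add, map_smul, hone _ hf, smul_eq_mul, mul_one, CharTwo.add_eq_zero, hχ'] at h0
  exact h0

theorem sum_powerset_fourierInd (A R : Finset (Fin n → ZMod 2)) (y : Fin n → ZMod 2) :
    ∑ I ∈ R.powerset, fourierInd A (∑ χ ∈ I, χ) * signChar ((∑ χ ∈ I, χ) ⬝ᵥ y) =
      2 ^ #R * #{x ∈ A | ∀ χ ∈ R, χ ⬝ᵥ x = χ ⬝ᵥ y} := by
  simp only [fourierInd, sum_mul, ← signChar_add, ← dotProduct_add]
  rw [sum_comm]
  simp only [sum_dotProduct, signChar_sum, ← prod_one_add]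
  rw [card_filter, Nat.cast_sum, mul_sum]
  refine sum_congr rfl fun x _ => ?_
  have hval : ∀ χ : Fin n → ZMod 2,
      1 + signChar (χ ⬝ᵥ (x + y)) = if χ ⬝ᵥ x = χ ⬝ᵥ y then 2 else 0 := by
    intro χ
    rw [dotProduct_add]
    generalize χ ⬝ᵥ x = a
    generalize χ ⬝ᵥ y = b
    revert a b
    decide
  simp only [hval]
  split_ifs with h
  · rw [prod_congr rfl fun χ hχ => if_pos (h χ hχ)]
    simp
  · push Not at h
    obtain ⟨χ, hχ, hne⟩ := h
    rw [prod_eq_zero hχ (if_neg hne)]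
    simp

/-- Every sum of elements of a circuit `R` that vanishes or lies in `R` is attained twice. -/
theorem sum_powerset_of_circuit {R : Finset (Fin n → ZMod 2)} (hR : 2 < #R)
    (hcirc : ∀ I ⊆ R, ∑ χ ∈ I, χ = 0 ↔ I = ∅ ∨ I = R) {g : (Fin n → ZMod 2) → ℤ}
    (hg : ∀ I ⊆ R, ∑ χ ∈ I, χ ≠ 0 → ∑ χ ∈ I, χ ∉ R → g (∑ χ ∈ I, χ) = 0) :
    ∑ I ∈ R.powerset, g (∑ χ ∈ I, χ) = 2 * (g 0 + ∑ χ ∈ R, g χ) := by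
  have h0 : (0 : Fin n → ZMod 2) ∉ R := by
    intro h
    have := (hcirc {0} (by simpa using h)).1 (by simp)
    rcases this with h | h
    · simp at h
    · rw [← h] at hR; simp at hR
  have hRne : R ≠ ∅ := by rintro rfl; simp at hR
  have hsumR : ∑ χ ∈ R, χ = 0 := (hcirc R Subset.rfl).2 (Or.inr rfl)
  have hcard : ∀ ω ∈ insert 0 R, #{I ∈ R.powerset | ∑ χ ∈ I, χ = ω} = 2 := by
    intro ω hω
    rcases mem_insert.1 hω with rfl | hω
    · have : ({I ∈ R.powerset | ∑ χ ∈ I, χ = 0} : Finset (Finset (Fin n → ZMod 2))) = {∅, R} := by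
        ext I
        simp only [mem_filter, mem_powerset, mem_insert, mem_singleton]
        constructor
        · rintro ⟨h1, h2⟩
          exact (hcirc I h1).1 h2
        · rintro (rfl | rfl)
          · simp
          · exact ⟨Subset.rfl, hsumR⟩
      rw [this, card_pair hRne.symm]
    · have : ({I ∈ R.powerset | ∑ χ ∈ I, χ = ω} : Finset (Finset (Fin n → ZMod 2))) =
          {{ω}, R.erase ω} := by
        ext I
        simp only [mem_filter, mem_powerset, mem_insert, mem_singleton]
        constructor
        · rintro ⟨h1, h2⟩
          by_cases hI : ω ∈ I
          · left
            have h3 : ∑ χ ∈ I.erase ω, χ = 0 := by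
              rw [← add_sum_erase I (fun χ => χ) hI] at h2
              simpa using h2
            rcases (hcirc _ ((erase_subset _ _).trans h1)).1 h3 with h | h
            · rcases (erase_eq_empty_iff _ _).1 h with h | h
              · simp [h] at hI
              · exact h
            · rw [← h] at hω
              simp at hω
          · right
            have h3 : ∑ χ ∈ insert ω I, χ = 0 := by
              rw [sum_insert hI, h2]
              exact vec_add_self ω
            rcases (hcirc _ (insert_subset hω h1)).1 h3 with h | h
            · simp at h
            · rw [← h, erase_insert hI]
        · rintro (rfl | rfl)
          · simpa using hω
          · refine ⟨erase_subset _ _, ?_⟩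
            rw [← add_sum_erase R (fun χ => χ) hω, vec_add_eq_zero] at hsumR
            exact hsumR.symm
      rw [this, card_pair]
      intro h
      have := congrArg Finset.card h
      rw [card_erase_of_mem hω] at this
      simp at this
      omega
  have hexp : ∀ I ∈ R.powerset, g (∑ χ ∈ I, χ) =
      ∑ ω ∈ insert 0 R, if ∑ χ ∈ I, χ = ω then g ω else 0 := by
    intro I hI
    rw [sum_ite_eq]
    split_ifs with h
    · rfl
    · rw [mem_insert, not_or] at h
      exact hg I (mem_powerset.1 hI) h.1 h.2
  rw [sum_congr rfl hexp, sum_comm, ← sum_insert h0, mul_sum]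
  refine sum_congr rfl fun ω hω => ?_
  rw [← sum_filter, sum_const, hcard ω hω]
  simp

theorem card_mul_le_of_dvd {α : Type*} (R : Finset α) {D C a₀ : ℤ} {a : α → ℤ}
    (ha : ∀ χ ∈ R, a χ ≠ 0)
    (hdvd : ∀ t : α → ZMod 2, D ∣ 2 * (a₀ + ∑ χ ∈ R, a χ * signChar (t χ)))
    (hnonneg : ∀ t : α → ZMod 2, 0 ≤ 2 * (a₀ + ∑ χ ∈ R, a χ * signChar (t χ)))
    (hle : ∀ t : α → ZMod 2, 2 * (a₀ + ∑ χ ∈ R, a χ * signChar (t χ)) ≤ C) :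
    #R * D ≤ C := by
  classical
  have h1 : ∀ χ ∈ R, D ≤ 4 * |a χ| := by
    intro χ hχ
    have hs : ∑ ω ∈ R, a ω * signChar ((0 : α → ZMod 2) ω) -
        ∑ ω ∈ R, a ω * signChar ((Pi.single χ 1 : α → ZMod 2) ω) = 2 * a χ := by
      rw [← sum_sub_distrib, sum_eq_single_of_mem χ hχ]
      · simp [signChar]
        ring
      · intro ω _ hne
        simp [hne]
    have := dvd_sub (hdvd 0) (hdvd (Pi.single χ 1))
    rw [← mul_sub, add_sub_add_left_eq_sub, hs] at this
    have h4 := Int.le_of_dvd (abs_pos.2 (by have := ha χ hχ; omega)) ((dvd_abs _ _).2 this)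
    rw [abs_mul, abs_mul] at h4
    norm_num at h4
    linarith
  have h2 := hle fun χ => if 0 ≤ a χ then 0 else 1
  have h3 := hnonneg fun χ => if 0 ≤ a χ then 1 else 0
  have e2 : ∑ χ ∈ R, a χ * signChar (if 0 ≤ a χ then 0 else 1) = ∑ χ ∈ R, |a χ| :=
    sum_congr rfl fun χ _ => by
      split_ifs with h
      · simp [signChar, abs_of_nonneg h]
      · simp [signChar, abs_of_neg (not_le.1 h)]
  have e3 : ∑ χ ∈ R, a χ * signChar (if 0 ≤ a χ then 1 else 0) = -∑ χ ∈ R, |a χ| := by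
    rw [← sum_neg_distrib]
    refine sum_congr rfl fun χ _ => ?_
    split_ifs with h
    · simp [signChar, abs_of_nonneg h]
    · simp [signChar, abs_of_neg (not_le.1 h)]
  rw [e2] at h2
  rw [e3] at h3
  have h4 : #R • D ≤ ∑ χ ∈ R, 4 * |a χ| := card_nsmul_le_sum _ _ _ h1
  rw [← mul_sum, nsmul_eq_mul] at h4
  linarith

/-- Suppose the transforms of `A` and `B` agree up to signs, the `k > 2` characters in `R` have no
relation other than summing to zero, the signs multiply to `-1` along `R`, and within the span of
`R` the nontrivial spectrum is exactly `R`. Then `k * 2 ^ k ≤ 2 ^ (n + 1)`. -/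
theorem card_mul_two_pow_le_of_circuit {A B R : Finset (Fin n → ZMod 2)}
    {e : (Fin n → ZMod 2) → ZMod 2} (hR : 2 < #R)
    (he : ∀ χ, fourierInd B χ = signChar (e χ) * fourierInd A χ)
    (h0 : fourierInd B 0 = fourierInd A 0)
    (hcirc : ∀ I ⊆ R, ∑ χ ∈ I, χ = 0 ↔ I = ∅ ∨ I = R)
    (hbad : ∑ χ ∈ R, e χ ≠ 0) (hsupp : ∀ χ ∈ R, fourierInd A χ ≠ 0)
    (hchord : ∀ I ⊆ R, ∑ χ ∈ I, χ ≠ 0 → ∑ χ ∈ I, χ ∉ R → fourierInd A (∑ χ ∈ I, χ) = 0) :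
    #R * 2 ^ #R ≤ 2 ^ (n + 1) := by
  have hR0 : (0 : Fin n → ZMod 2) ∉ R := by
    intro h
    rcases (hcirc {0} (by simpa using h)).1 (by simp) with h | h
    · simp at h
    · rw [← h] at hR; simp at hR
  have hfiber : ∀ (D : Finset (Fin n → ZMod 2)), (∀ I ⊆ R, ∑ χ ∈ I, χ ≠ 0 → ∑ χ ∈ I, χ ∉ R →
      fourierInd D (∑ χ ∈ I, χ) = 0) → ∀ y, 2 * (fourierInd D 0 + ∑ χ ∈ R, fourierInd D χ *
        signChar (χ ⬝ᵥ y)) = 2 ^ #R * #{x ∈ D | ∀ χ ∈ R, χ ⬝ᵥ x = χ ⬝ᵥ y} := by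
    intro D hD y
    rw [← sum_powerset_fourierInd, sum_powerset_of_circuit hR hcirc
      (g := fun χ => fourierInd D χ * signChar (χ ⬝ᵥ y))]
    · simp [signChar_zero]
    · intro I hI h1 h2
      simp [hD I hI h1 h2]
  have huniv : ∀ y : Fin n → ZMod 2,
      (2 : ℤ) ^ #R * #{x | ∀ χ ∈ R, χ ⬝ᵥ x = χ ⬝ᵥ y} = 2 ^ (n + 1) := by
    intro y
    rw [← hfiber univ (fun I _ h _ => by simp [fourierInd_univ, h])]
    have : ∀ χ ∈ R, fourierInd univ χ * signChar (χ ⬝ᵥ y) = 0 := fun χ hχ => by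
      rw [fourierInd_univ, if_neg (ne_of_mem_of_not_mem hχ hR0), zero_mul]
    rw [sum_eq_zero this, fourierInd_univ]
    simp
    ring
  have hval : ∀ t : (Fin n → ZMod 2) → ZMod 2, ∃ D : Finset (Fin n → ZMod 2), ∃ y,
      2 * (fourierInd A 0 + ∑ χ ∈ R, fourierInd A χ * signChar (t χ)) =
        2 ^ #R * #{x ∈ D | ∀ χ ∈ R, χ ⬝ᵥ x = χ ⬝ᵥ y} := by
    intro t
    have hext : ∀ t' : (Fin n → ZMod 2) → ZMod 2, ∑ χ ∈ R, t' χ = 0 →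
        ∃ y, ∀ χ ∈ R, χ ⬝ᵥ y = t' χ := by
      intro t' ht'
      refine exists_dotProduct_eq R t' fun I hI hsum => ?_
      rcases (hcirc I (by exact_mod_cast hI)).1 hsum with rfl | rfl
      · simp
      · exact ht'
    by_cases ht : ∑ χ ∈ R, t χ = 0
    · obtain ⟨y, hy⟩ := hext t ht
      refine ⟨A, y, ?_⟩
      rw [← hfiber A hchord]
      congr 2
      exact sum_congr rfl fun χ hχ => by rw [hy χ hχ]
    · obtain ⟨y, hy⟩ := hext (fun χ => t χ + e χ) (by
        rw [sum_add_distrib]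
        have : ∀ a b : ZMod 2, a ≠ 0 → b ≠ 0 → a + b = 0 := by decide
        exact this _ _ ht hbad)
      refine ⟨B, y, ?_⟩
      rw [← hfiber B fun I hI h1 h2 => by rw [he, hchord I hI h1 h2, mul_zero], h0]
      congr 2
      refine sum_congr rfl fun χ hχ => ?_
      rw [hy χ hχ, he, signChar_add]
      linear_combination -fourierInd A χ * signChar (t χ) * signChar_mul_self (e χ)
  have := card_mul_le_of_dvd R (D := 2 ^ #R) (C := 2 ^ (n + 1)) (a₀ := fourierInd A 0) hsupp
    (fun t => ?_) (fun t => ?_) (fun t => ?_)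
  · exact_mod_cast this
  all_goals obtain ⟨D, y, hD⟩ := hval t
  · exact ⟨_, hD⟩
  · rw [hD]
    positivity
  · rw [hD, ← huniv y]
    gcongr
    exact subset_univ D

theorem exists_translate_of_indist {r : ℕ} (hr : 2 ≤ r) (hnr : 2 ^ (n + 1) < (r + 1) * 2 ^ (r + 1))
    {A B : Finset (Fin n → ZMod 2)} (h : Indist r (indic A) (indic B)) :
    ∃ z : Fin n → ZMod 2, B = A.image (fun x => z + x) := by
  have h0 : fourierInd B 0 = fourierInd A 0 := by
    have := prod_fourierInd_eq h (k := 1) (by omega) (χ := fun _ => 0) (by simp)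
    simpa using this.symm
  have hsign : ∀ χ, ∃ a, fourierInd B χ = signChar a * fourierInd A χ := by
    intro χ
    have := prod_fourierInd_eq h (k := 2) hr (χ := fun _ => χ)
      (by rw [Fin.sum_univ_two, vec_add_self])
    simp only [prod_const, card_univ, Fintype.card_fin] at this
    rcases sq_eq_sq_iff_eq_or_eq_neg.1 this.symm with h | h
    · exact ⟨0, by simp [h, signChar]⟩
    · exact ⟨1, by simp [h, signChar]⟩
  choose e he using hsign
  by_cases hrel : ∀ R : Finset (Fin n → ZMod 2), ↑R ⊆ {χ | fourierInd A χ ≠ 0} →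
      ∑ χ ∈ R, χ = 0 → ∑ χ ∈ R, e χ = 0
  · obtain ⟨z, hz⟩ := exists_dotProduct_eq _ e hrel
    refine ⟨z, fourierInd_injective (funext fun χ => ?_)⟩
    rw [fourierInd_image_add, he]
    by_cases hχ : fourierInd A χ = 0
    · simp [hχ]
    · rw [hz χ hχ]
  exfalso
  classical
  let bad : Finset (Finset (Fin n → ZMod 2)) :=
    {R | (∀ χ ∈ R, fourierInd A χ ≠ 0) ∧ ∑ χ ∈ R, χ = 0 ∧ ∑ χ ∈ R, e χ ≠ 0}
  have hmem : ∀ {R}, R ∈ bad ↔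
      (∀ χ ∈ R, fourierInd A χ ≠ 0) ∧ ∑ χ ∈ R, χ = 0 ∧ ∑ χ ∈ R, e χ ≠ 0 := by
    simp [bad]
  have hne : bad.Nonempty := by
    push Not at hrel
    obtain ⟨R, h1, h2, h3⟩ := hrel
    exact ⟨R, hmem.2 ⟨fun χ hχ => h1 hχ, h2, h3⟩⟩
  obtain ⟨R, hR, hmin⟩ := exists_min_image bad Finset.card hne
  obtain ⟨hsupp, hsum, hbad⟩ := hmem.1 hR
  have hcard : r < #R := by
    by_contra! hle
    have hp := prod_finset_fourierInd_eq h hle hsum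
    simp only [he, prod_mul_distrib, ← signChar_sum] at hp
    have hp0 : ∏ χ ∈ R, fourierInd A χ ≠ 0 := prod_ne_zero_iff.2 hsupp
    exact hbad (signChar_eq_one_iff.1 (mul_right_cancel₀ hp0 (by rw [one_mul, ← hp])))
  have hzero : ∀ {I}, I ⊆ R → #I < #R → ∑ χ ∈ I, χ = 0 → ∑ χ ∈ I, e χ = 0 := by
    intro I hI hlt hs
    by_contra hb
    exact hlt.not_ge (hmin I (hmem.2 ⟨fun χ hχ => hsupp χ (hI hχ), hs, hb⟩))
  have hcirc : ∀ I ⊆ R, ∑ χ ∈ I, χ = 0 ↔ I = ∅ ∨ I = R := by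
    intro I hI
    refine ⟨fun hs => ?_, ?_⟩
    · by_contra! hne
      have hs' : ∑ χ ∈ R \ I, χ = 0 := by
        have := sum_sdiff (f := fun χ => χ) hI
        rwa [hs, hsum, add_zero] at this
      have h1 := hzero hI (card_lt_card (hI.ssubset_of_ne hne.2)) hs
      have h2 := hzero sdiff_subset (card_lt_card (sdiff_ssubset hI (hne.1)))
        hs'
      have := sum_sdiff (f := e) hI
      rw [h1, h2, add_zero] at this
      exact hbad this.symm
    · rintro (rfl | rfl)
      · simp
      · exact hsum
  have hchord : ∀ I ⊆ R, ∑ χ ∈ I, χ ≠ 0 → ∑ χ ∈ I, χ ∉ R → fourierInd A (∑ χ ∈ I, χ) = 0 := by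
    intro I hI h1 h2
    by_contra hA
    set ω := ∑ χ ∈ I, χ with hω
    have hs' : ∑ χ ∈ R \ I, χ = ω := by
      have := sum_sdiff (f := fun χ => χ) hI
      rwa [← hω, hsum, vec_add_eq_zero] at this
    have key : ∀ {J}, J ⊆ R → ∑ χ ∈ J, χ = ω → #J + 1 < #R → e ω = ∑ χ ∈ J, e χ := by
      intro J hJ hs hlt
      have hωJ : ω ∉ J := fun h => h2 (hJ h)
      by_contra hb
      have := hmin (insert ω J) (hmem.2 ⟨?_, ?_, ?_⟩)
      · rw [card_insert_of_notMem hωJ] at this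
        omega
      · intro χ hχ
        rcases mem_insert.1 hχ with rfl | hχ
        · exact hA
        · exact hsupp χ (hJ hχ)
      · rw [sum_insert hωJ, hs]
        exact vec_add_self ω
      · rw [sum_insert hωJ, Ne, CharTwo.add_eq_zero]
        exact hb
    have hlarge : ∀ {J}, J ⊆ R → ∑ χ ∈ J, χ = ω → 1 < #J := by
      intro J hJ hs
      by_contra! hle
      rcases Nat.le_one_iff_eq_zero_or_eq_one.1 hle with h | h
      · rw [card_eq_zero.1 h] at hs
        exact h1 (by simpa using hs.symm)
      · obtain ⟨χ, rfl⟩ := card_eq_one.1 h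
        rw [sum_singleton] at hs
        exact h2 (hs ▸ hJ (mem_singleton_self χ))
    have c1 := hlarge hI rfl
    have c2 := hlarge sdiff_subset hs'
    have c3 := card_sdiff_add_card_eq_card hI
    have k1 := key hI rfl (by omega)
    have k2 := key sdiff_subset hs' (by omega)
    have := sum_sdiff (f := e) hI
    rw [← k1, ← k2, CharTwo.add_self_eq_zero] at this
    exact hbad this.symm
  have hle := card_mul_two_pow_le_of_circuit (by omega) he h0 hcirc hbad hsupp hchord
  have hge : (r + 1) * 2 ^ (r + 1) ≤ #R * 2 ^ #R :=
    Nat.mul_le_mul hcard (Nat.pow_le_pow_right (by norm_num) hcard)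
  omega

end Fourier

theorem exists_translate_of_indist_one {A B : Finset (Fin 1 → ZMod 2)}
    (h : Indist 1 (indic A) (indic B)) : ∃ z : Fin 1 → ZMod 2, B = A.image (fun x => z + x) := by
  have hcard : #A = #B := by
    have := prod_fourierInd_eq h (k := 1) le_rfl (χ := fun _ => 0) (by simp)
    simpa [fourierInd_zero] using this
  have : ∀ A B : Finset (Fin 1 → ZMod 2), #A = #B →
      ∃ z : Fin 1 → ZMod 2, B = A.image (fun x => z + x) := by decide
  exact this A B hcard

/-- For every positive integer `n`, the reconstruction number of `𝔽₂^n` is exactly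
`r = ⌊n + 1 − log₂(n + 1 − log₂ n)⌋`: any two `r`-indistinguishable subsets of `𝔽₂^n`
are translates of one another, and there exist two `(r-1)`-indistinguishable subsets of
`𝔽₂^n` that are not translates of one another. -/
theorem stmt16 (n : ℕ) (hn : 0 < n) (r : ℕ)
    (hr : (r : ℤ) = ⌊(n : ℝ) + 1 - Real.logb 2 ((n : ℝ) + 1 - Real.logb 2 n)⌋) :
    (∀ A B : Finset (Fin n → ZMod 2), Indist r (indic A) (indic B) →
      ∃ z : Fin n → ZMod 2, B = A.image (fun x => z + x)) ∧
    (∃ A B : Finset (Fin n → ZMod 2), Indist (r - 1) (indic A) (indic B) ∧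
      ¬ ∃ z : Fin n → ZMod 2, B = A.image (fun x => z + x)) := by
  obtain ⟨hrn, hle, hlt⟩ := pow_bounds_of_floor hn hr
  have hr0 : r ≠ 0 := by
    rintro rfl
    simp at hlt
  refine ⟨fun A B h => ?_, ?_⟩
  · rcases Nat.lt_or_ge r 2 with hr2 | hr2
    · obtain rfl : r = 1 := by omega
      obtain rfl : n = 1 := by
        by_contra hne
        have : 2 ^ 1 ≤ 2 ^ (n - 1) := Nat.pow_le_pow_right (by norm_num) (by omega)
        omega
      exact exists_translate_of_indist_one h
    · refine exists_translate_of_indist hr2 ?_ h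
      calc 2 ^ (n + 1) = 2 ^ (n - r) * 2 ^ (r + 1) := by rw [← pow_add]; congr 1; omega
        _ < (r + 1) * 2 ^ (r + 1) := by gcongr
  · obtain ⟨m, rfl⟩ := Nat.exists_eq_succ_of_ne_zero hr0
    obtain ⟨d, rfl⟩ := Nat.exists_eq_add_of_le (show m ≤ n by omega)
    rw [show m + d + 1 - m.succ = d by omega] at hle
    exact exists_indist_not_translate hle
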